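/- Let A be a unital associative algebra over a commutative unital ring R that is 2-torsion free and (n−1)-torsion free, let e be a nontrivial idempotent in A and f = 1 − e, suppose A satisfies property (Q), let n ≥ 2, and let φ be a Lie n-derivation on A. Then φ is standard if and only if: (i) fφ(a)f ∈ fZ(A)f for every a ∈ eAe and eφ(b)e ∈ eZ(A)e for every b ∈ fAf; (ii) eφ(tm)e + fφ(mt)f ∈ Z(A) for every m ∈ eAf and t ∈ fAe; and (iii) fφ(m)e = 0 for every m ∈ eAf and eφ(t)f = 0 for every t ∈ fAe. -/

import Mathlib

open Finset

/-- Iterated commutator: `pCom x k = p_{k+1}(x 0, ..., x k)`, i.e.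
`pCom x 0 = x 0` and `pCom x (k+1) = [pCom x k, x (k+1)]`. -/
def pCom {A : Type*} [Ring A] (x : ℕ → A) : ℕ → A
  | 0 => x 0
  | k + 1 => pCom x k * x (k + 1) - x (k + 1) * pCom x k

/-- `φ` is a Lie `n`-derivation. -/
def IsLieNDeriv {R : Type*} {A : Type*} [CommRing R] [Ring A] [Algebra R A]
    (n : ℕ) (φ : A →ₗ[R] A) : Prop :=
  ∀ x : ℕ → A,
    φ (pCom x (n - 1)) =
      ∑ i ∈ Finset.range n, pCom (Function.update x i (φ (x i))) (n - 1)

/-- `d` is a derivation. -/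
def IsDeriv {R : Type*} {A : Type*} [CommRing R] [Ring A] [Algebra R A]
    (d : A →ₗ[R] A) : Prop :=
  ∀ x y : A, d (x * y) = d x * y + x * d y

/-- `δ` is a Jordan derivation. -/
def IsJordanDeriv {R : Type*} {A : Type*} [CommRing R] [Ring A] [Algebra R A]
    (δ : A →ₗ[R] A) : Prop :=
  ∀ x y : A, δ (x * y + y * x) = δ x * y + y * δ x + x * δ y + δ y * x

/-- `δ` is an antiderivation. -/
def IsAntiDeriv {R : Type*} {A : Type*} [CommRing R] [Ring A] [Algebra R A]
    (δ : A →ₗ[R] A) : Prop :=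
  ∀ x y : A, δ (x * y) = δ y * x + y * δ x

/-- `δ` is a singular Jordan derivation relative to the idempotent `e`
(with `f = 1 - e`): it is a Jordan derivation killing `eAe` and `fAf`,
mapping `eAf` into `fAe` and `fAe` into `eAf`. -/
def IsSingularJordanDeriv {R : Type*} {A : Type*} [CommRing R] [Ring A] [Algebra R A]
    (e : A) (δ : A →ₗ[R] A) : Prop :=
  IsJordanDeriv δ ∧
  (∀ a : A, δ (e * a * e) = 0) ∧
  (∀ b : A, δ ((1 - e) * b * (1 - e)) = 0) ∧
  (∀ m : A, δ (e * m * (1 - e)) = (1 - e) * δ (e * m * (1 - e)) * e) ∧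
  (∀ t : A, δ ((1 - e) * t * e) = e * δ ((1 - e) * t * e) * (1 - e))

/-- `z` is a central element. -/
def IsCent {A : Type*} [Ring A] (z : A) : Prop := ∀ y : A, z * y = y * z

/-- The centre of `A` as a set. -/
def centerSet (A : Type*) [Ring A] : Set A := {z : A | ∀ y : A, z * y = y * z}

/-- `γ` vanishes on all `(n-1)`-th commutators. -/
def VanishesOnNCommutators {R : Type*} {A : Type*} [CommRing R] [Ring A] [Algebra R A]
    (n : ℕ) (γ : A →ₗ[R] A) : Prop :=
  ∀ x : ℕ → A, γ (pCom x (n - 1)) = 0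

/-- A Lie `n`-derivation is standard if it is the sum of a derivation and a
central-valued map vanishing on all `(n-1)`-th commutators. -/
def IsStandardLieNDeriv {R : Type*} {A : Type*} [CommRing R] [Ring A] [Algebra R A]
    (n : ℕ) (φ : A →ₗ[R] A) : Prop :=
  ∃ d γ : A →ₗ[R] A,
    IsDeriv d ∧ (∀ x : A, IsCent (γ x)) ∧ VanishesOnNCommutators n γ ∧ φ = d + γ

/-- Property (Q) for the idempotent `e` (with `f = 1 - e`):
`exe·eAf = 0 = fAe·exe` implies `exe = 0`, and
`eAf·fxf = 0 = fxf·fAe` implies `fxf = 0`. -/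
def PropQ {A : Type*} [Ring A] (e : A) : Prop :=
  (∀ x : A,
    ((∀ y : A, (e * x * e) * (e * y * (1 - e)) = 0) ∧
     (∀ y : A, ((1 - e) * y * e) * (e * x * e) = 0)) → e * x * e = 0) ∧
  (∀ x : A,
    ((∀ y : A, (e * y * (1 - e)) * ((1 - e) * x * (1 - e)) = 0) ∧
     (∀ y : A, ((1 - e) * x * (1 - e)) * ((1 - e) * y * e) = 0)) →
        (1 - e) * x * (1 - e) = 0)

/-- `A` is `k`-torsion free. -/
def TorsionFreeAt (A : Type*) [Ring A] (k : ℕ) : Prop :=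
  ∀ x : A, k • x = 0 → x = 0

/-- The centre of the corner algebra `gAg` (for an idempotent `g`). -/
def cornerCenter {A : Type*} [Ring A] (g : A) : Set A :=
  {z : A | z = g * z * g ∧ ∀ a : A, z * (g * a * g) = (g * a * g) * z}

/-- The corner algebra `gAg` has no nonzero central ideal: every
ideal of `gAg` consisting of elements central in `gAg` is zero. -/
def NoNonzeroCentralIdeal (R : Type*) [CommRing R] (A : Type*) [Ring A] [Algebra R A]
    (g : A) : Prop :=
  ∀ I : Set A, (0 : A) ∈ I →
    (∀ x ∈ I, x = g * x * g) →
    (∀ x ∈ I, ∀ y ∈ I, x + y ∈ I) →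
    (∀ r : R, ∀ x ∈ I, r • x ∈ I) →
    (∀ x ∈ I, ∀ a : A, (g * a * g) * x ∈ I) →
    (∀ x ∈ I, ∀ a : A, x * (g * a * g) ∈ I) →
    (∀ x ∈ I, ∀ a : A, x * (g * a * g) = (g * a * g) * x) →
    ∀ x ∈ I, x = 0

/-- The generating set of `S(gAg)`: all idempotents of `gAg` together with all
commutators of elements of `gAg`. -/
def cornerGenSet {A : Type*} [Ring A] (g : A) : Set A :=
  {x : A | x = g * x * g ∧ x * x = x} ∪
  {x : A | ∃ a b : A, x = (g * a * g) * (g * b * g) - (g * b * g) * (g * a * g)}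

/-- `gAg = S(gAg)`: the corner algebra is generated (as an algebra) by its
idempotents and commutators. -/
def CornerGenerated (R : Type*) [CommRing R] {A : Type*} [Ring A] [Algebra R A]
    (g : A) : Prop :=
  ∀ x : A, g * x * g ∈ NonUnitalAlgebra.adjoin R (cornerGenSet g)

/-- Condition (*) for the corner algebra `gAg`: if `[x, gAg] ⊆ Z(gAg)` then
`x ∈ Z(gAg)`. -/
def CornerCondStar {A : Type*} [Ring A] (g : A) : Prop :=
  ∀ x : A, x = g * x * g →
    (∀ a : A, x * (g * a * g) - (g * a * g) * x ∈ cornerCenter g) →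
    x ∈ cornerCenter g

section IteratedCommutators

variable {R A : Type*} [CommRing R] [Ring A] [Algebra R A]

lemma pCom_congr {x y : ℕ → A} {k : ℕ} (h : ∀ i ≤ k, x i = y i) : pCom x k = pCom y k := by
  induction k with
  | zero => exact h 0 le_rfl
  | succ k ih =>
    simp only [pCom]
    rw [ih fun i hi => h i (by omega), h (k + 1) le_rfl]

lemma pCom_update_of_lt (x : ℕ → A) {i k : ℕ} (h : k < i) (a : A) :
    pCom (Function.update x i a) k = pCom x k :=
  pCom_congr fun j hj => Function.update_of_ne (by omega) _ _

lemma pCom_update_last (x : ℕ → A) (k : ℕ) (a : A) :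
    pCom (Function.update x (k + 1) a) (k + 1) = pCom x k * a - a * pCom x k := by
  simp only [pCom]
  rw [pCom_update_of_lt x (Nat.lt_succ_self k), Function.update_self]

lemma pCom_update_succ (x : ℕ → A) {i k : ℕ} (h : i ≤ k) (a : A) :
    pCom (Function.update x i a) (k + 1) =
      pCom (Function.update x i a) k * x (k + 1) - x (k + 1) * pCom (Function.update x i a) k := by
  simp only [pCom]
  rw [Function.update_of_ne (by omega)]

lemma pCom_update_add (x : ℕ → A) {i k : ℕ} (h : i ≤ k) (a b : A) :
    pCom (Function.update x i (a + b)) k =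
      pCom (Function.update x i a) k + pCom (Function.update x i b) k := by
  induction k with
  | zero =>
    obtain rfl : i = 0 := by omega
    simp [pCom]
  | succ k ih =>
    rcases Nat.lt_or_ge k i with hk | hk
    · obtain rfl : i = k + 1 := by omega
      simp only [pCom_update_last]
      noncomm_ring
    · simp only [pCom_update_succ x hk, ih hk]
      noncomm_ring

lemma pCom_eq_zero_of_isCent {x : ℕ → A} {i k : ℕ} (h : i ≤ k + 1) (hx : IsCent (x i)) :
    pCom x (k + 1) = 0 := by
  induction k with
  | zero =>
    simp only [pCom]
    rcases Nat.le_one_iff_eq_zero_or_eq_one.mp h with rfl | rfl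
    · rw [hx, sub_self]
    · rw [← hx, sub_self]
  | succ k ih =>
    rcases Nat.lt_or_ge (k + 1) i with hk | hk
    · obtain rfl : i = k + 1 + 1 := by omega
      rw [pCom, ← hx, sub_self]
    · rw [pCom, ih hk, zero_mul, mul_zero, sub_zero]

lemma pCom_update_eq_zero (x : ℕ → A) {i k : ℕ} (h : i ≤ k + 1) {z : A} (hz : IsCent z) :
    pCom (Function.update x i z) (k + 1) = 0 :=
  pCom_eq_zero_of_isCent h (by rwa [Function.update_self])

lemma IsDeriv.map_pCom {d : A →ₗ[R] A} (hd : IsDeriv d) (x : ℕ → A) (k : ℕ) :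
    d (pCom x k) = ∑ i ∈ range (k + 1), pCom (Function.update x i (d (x i))) k := by
  induction k with
  | zero => simp [pCom]
  | succ k ih =>
    have hsum : ∑ i ∈ range (k + 1), pCom (Function.update x i (d (x i))) (k + 1) =
        d (pCom x k) * x (k + 1) - x (k + 1) * d (pCom x k) := by
      rw [ih, sum_mul, mul_sum, ← sum_sub_distrib]
      exact sum_congr rfl fun i hi =>
        pCom_update_succ x (by have := mem_range.mp hi; omega) _
    rw [sum_range_succ, hsum, pCom_update_last, pCom, map_sub, hd, hd]
    abel

lemma IsLieNDeriv.sub_isDeriv {N : ℕ} {φ d : A →ₗ[R] A} (hφ : IsLieNDeriv (N + 2) φ)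
    (hd : IsDeriv d) : IsLieNDeriv (N + 2) (φ - d) := by
  intro x
  have h1 := hφ x
  have h2 := hd.map_pCom x (N + 1)
  simp only [show N + 2 - 1 = N + 1 by omega] at h1 ⊢
  rw [LinearMap.sub_apply, h1, h2, ← sum_sub_distrib]
  refine sum_congr rfl fun i hi => ?_
  have hi' : i ≤ N + 1 := by have := mem_range.mp hi; omega
  rw [sub_eq_iff_eq_add, ← pCom_update_add x hi', LinearMap.sub_apply, sub_add_cancel]

lemma vanishesOnNCommutators_of_isLieNDeriv {N : ℕ} {γ : A →ₗ[R] A}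
    (h : IsLieNDeriv (N + 2) γ) (hγ : ∀ x, IsCent (γ x)) :
    VanishesOnNCommutators (N + 2) γ := by
  intro x
  rw [h x]
  exact sum_eq_zero fun i hi =>
    pCom_update_eq_zero x (by have := mem_range.mp hi; omega) (hγ _)

/-- If `[v, e] = s • v` then bracketing `v` repeatedly with `e` multiplies it by powers of `s`. -/
lemma pCom_eq_pow_smul {e v : A} {s : ℤ} (hv : v * e - e * v = s • v) {x : ℕ → A} {j k : ℕ}
    (hk : j ≤ k) (hj : pCom x j = v) (hx : ∀ i, j < i → i ≤ k → x i = e) :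
    pCom x k = s ^ (k - j) • v := by
  induction k, hk using Nat.le_induction with
  | base => simpa using hj
  | succ k hk ih =>
    rw [pCom, ih fun i hi hi' => hx i hi (by omega), hx (k + 1) (by omega) le_rfl,
      show k + 1 - j = (k - j) + 1 by omega, pow_succ, mul_smul, ← hv, smul_mul_assoc,
      mul_smul_comm, smul_sub]

lemma pow_smul_cancel {s : ℤ} (hs : s * s = 1) (N : ℕ) {v w : A} (h : s ^ N • v = s ^ N • w) :
    v = w := by
  have h' : s ^ N • s ^ N • v = s ^ N • s ^ N • w := congrArg (s ^ N • ·) h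
  simpa only [smul_smul, ← mul_pow, hs, one_pow, one_smul] using h'

/-- If `φ e` is central then `φ` acts as a Lie derivation on commutators `[x, y]` which are
eigenvectors of the commutator with `e`. -/
lemma IsLieNDeriv.map_commutator_of_eigen {N : ℕ} {φ : A →ₗ[R] A} (hφ : IsLieNDeriv (N + 2) φ)
    {e : A} (hc : IsCent (φ e)) {s : ℤ} (hs : s * s = 1) {x y w : A}
    (hw : (x * y - y * x) * e - e * (x * y - y * x) = s • (x * y - y * x))
    (hφw : φ x * y - y * φ x + (x * φ y - φ y * x) = w) (hw' : w * e - e * w = s • w) :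
    φ (x * y - y * x) = w := by
  let u : ℕ → A := fun i => if i = 0 then x else if i = 1 then y else e
  have h := hφ u
  have hu : ∀ i, 1 < i → i ≤ N + 1 → u i = e := fun i hi _ => by
    simp only [u]; rw [if_neg (by omega), if_neg (by omega)]
  simp only [show N + 2 - 1 = N + 1 by omega] at h
  rw [sum_range_succ', sum_range_succ', sum_eq_zero, zero_add,
    pCom_eq_pow_smul hw (j := 1) (by omega) (by simp [pCom, u]) hu] at h
  · apply pow_smul_cancel hs N
    rw [← map_zsmul]
    simp only [Nat.add_sub_cancel, zero_add] at h
    rw [h]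
    have key : ∀ k, (pCom (Function.update u 1 (φ (u 1))) (k + 1) +
        pCom (Function.update u 0 (φ (u 0))) (k + 1)) = s ^ k • w := by
      intro k
      induction k with
      | zero => simp [pCom, u, ← hφw]; abel
      | succ k ih =>
        rw [pCom_update_succ u (i := 1) (by omega), pCom_update_succ u (i := 0) (by omega)]
        have : u (k + 1 + 1) = e := by simp [u]
        rw [this, pow_succ, mul_smul, ← hw', smul_sub, ← smul_mul_assoc, ← mul_smul_comm, ← ih]
        noncomm_ring
    exact key N
  · intro i hi
    refine pCom_update_eq_zero u (by have := mem_range.mp hi; omega) ?_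
    simpa [u] using hc

/-- If `φ e` is central then `φ` acts as a Lie derivation on commutators `[x, y]` for which `x`
and `φ x` are eigenvectors of the commutator with `e`. -/
lemma IsLieNDeriv.map_commutator_of_eigen_left {N : ℕ} {φ : A →ₗ[R] A}
    (hφ : IsLieNDeriv (N + 2) φ) {e : A} (hc : IsCent (φ e)) {s : ℤ} (hs : s * s = 1) {x y : A}
    (hx : x * e - e * x = s • x) (hx' : φ x * e - e * φ x = s • φ x) :
    φ (x * y - y * x) = φ x * y - y * φ x + (x * φ y - φ y * x) := by
  let u : ℕ → A := fun i => if i = 0 then x else if i = N + 1 then y else e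
  have h := hφ u
  have hu : ∀ i, 0 < i → i ≤ N → u i = e := fun i hi _ => by
    simp only [u]; rw [if_neg (by omega), if_neg (by omega)]
  have hlast : u (N + 1) = y := by simp [u]
  have hu0 : pCom u N = s ^ N • x := by
    simpa using pCom_eq_pow_smul hx (Nat.zero_le N) (by simp [pCom, u]) hu
  have hu1 : pCom (Function.update u 0 (φ x)) N = s ^ N • φ x := by
    simpa using pCom_eq_pow_smul hx' (Nat.zero_le N) (by simp [pCom])
      fun i hi hi' => by rw [Function.update_of_ne (by omega), hu i hi hi']
  simp only [show N + 2 - 1 = N + 1 by omega] at h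
  rw [sum_range_succ, sum_range_succ', sum_eq_zero, zero_add, pCom_update_last,
    show u 0 = x from rfl, pCom_update_succ u (Nat.zero_le N), pCom, hu0, hu1, hlast] at h
  · apply pow_smul_cancel hs N
    rw [← map_zsmul]
    simp only [smul_sub, smul_add, smul_mul_assoc, mul_smul_comm] at h ⊢
    exact h
  · intro i hi
    have := mem_range.mp hi
    refine pCom_update_eq_zero u (by omega) ?_
    rw [hu _ (by omega) (by omega)]
    exact hc

/-- The defining identity evaluated at `(v, e, …, e)`. -/
lemma IsLieNDeriv.map_eigen {N : ℕ} {φ : A →ₗ[R] A} (hφ : IsLieNDeriv (N + 2) φ)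
    {e v w : A} {s : ℤ} (hv : v * e - e * v = s • v) (hw : v * φ e - φ e * v = w)
    (hw' : w * e - e * w = s • w) :
    s ^ (N + 1) • φ v = pCom (fun i => if i = 0 then φ v else e) (N + 1) +
      (N + 1) • s ^ N • w := by
  let u : ℕ → A := fun i => if i = 0 then v else e
  have h := hφ u
  have hu : ∀ i, 0 < i → u i = e := fun i hi => by
    simp only [u]; rw [if_neg (by omega)]
  have hpow : ∀ k, pCom u k = s ^ k • v := fun k => by
    simpa using pCom_eq_pow_smul hv (Nat.zero_le k) (by simp [pCom, u]) fun i hi _ => hu i hi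
  simp only [show N + 2 - 1 = N + 1 by omega] at h
  rw [sum_range_succ', hpow, map_zsmul] at h
  rw [h, add_comm]
  congr 1
  · apply pCom_congr
    intro i _
    rcases Nat.eq_zero_or_pos i with rfl | hi
    · simp [u]
    · rw [Function.update_of_ne (by omega), hu i hi, if_neg (by omega)]
  · rw [← card_range (N + 1), ← sum_const, card_range]
    refine sum_congr rfl fun i hi => ?_
    have hi' := mem_range.mp hi
    have hsw : (s ^ i • w) * e - e * (s ^ i • w) = s • s ^ i • w := by
      rw [smul_mul_assoc, mul_smul_comm, ← smul_sub, hw', smul_comm]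
    rw [hu _ (Nat.succ_pos i), pCom_eq_pow_smul hsw (j := i + 1) (by omega) ?_ ?_, smul_smul,
      ← pow_add]
    · congr 2; omega
    · rw [pCom_update_last, hpow, ← hw, smul_mul_assoc, mul_smul_comm, smul_sub]
    · intro j hj _
      rw [Function.update_of_ne (by omega), hu j (by omega)]

end IteratedCommutators

section Corners

variable {R A : Type*} [CommRing R] [Ring A] [Algebra R A]

/-- `x` lies in the Peirce corner `pAq`. -/
def InCorner (p q x : A) : Prop := p * x = x ∧ x * q = x

/-- `e` and `f` are complementary idempotents. -/
structure PeircePair (e f : A) : Prop where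
  left : e * e = e
  right : f * f = f
  mul : e * f = 0
  mul' : f * e = 0
  add : e + f = 1

lemma PeircePair.symm {e f : A} (h : PeircePair e f) : PeircePair f e :=
  ⟨h.right, h.left, h.mul', h.mul, by rw [add_comm, h.add]⟩

/-- The part of property (Q) concerning the corner `eAe`. -/
def HalfQ (e f : A) : Prop :=
  ∀ x, InCorner e e x → (∀ m, InCorner e f m → x * m = 0) →
    (∀ t, InCorner f e t → t * x = 0) → x = 0

lemma inCorner_mul_mul {p q : A} (hp : p * p = p) (hq : q * q = q) (x : A) :
    InCorner p q (p * x * q) :=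
  ⟨by rw [← mul_assoc, ← mul_assoc, hp], by rw [mul_assoc, hq]⟩

namespace InCorner

variable {p q r s x y : A}

lemma eq (h : InCorner p q x) : p * x * q = x := by rw [h.1, h.2]

lemma add (hx : InCorner p q x) (hy : InCorner p q y) : InCorner p q (x + y) :=
  ⟨by rw [mul_add, hx.1, hy.1], by rw [add_mul, hx.2, hy.2]⟩

lemma sub (hx : InCorner p q x) (hy : InCorner p q y) : InCorner p q (x - y) :=
  ⟨by rw [mul_sub, hx.1, hy.1], by rw [sub_mul, hx.2, hy.2]⟩

lemma mul (hx : InCorner p q x) (hy : InCorner r s y) : InCorner p s (x * y) :=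
  ⟨by rw [← mul_assoc, hx.1], by rw [mul_assoc, hy.2]⟩

lemma mul_eq_zero (hx : InCorner p q x) (hy : InCorner r s y) (h : q * r = 0) : x * y = 0 := by
  rw [← hx.2, ← hy.1, mul_assoc, ← mul_assoc q, h, zero_mul, mul_zero]

lemma left_eq_zero (hx : InCorner p q x) (h : r * p = 0) : r * x = 0 := by
  rw [← hx.1, ← mul_assoc, h, zero_mul]

lemma right_eq_zero (hx : InCorner p q x) (h : q * r = 0) : x * r = 0 := by
  rw [← hx.2, mul_assoc, h, mul_zero]

end InCorner

lemma PeircePair.decomp {e f : A} (h : PeircePair e f) (x : A) :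
    x = e * x * e + e * x * f + (f * x * e + f * x * f) := by
  rw [← mul_add, ← mul_add, h.add, mul_one, mul_one, ← add_mul, h.add, one_mul]

/-- A diagonal element commuting with the off-diagonal corners commutes with `eAe`. -/
lemma HalfQ.commute {e f : A} (hQ : HalfQ e f) {a b : A}
    (ha : InCorner e e a) (hm : ∀ m, InCorner e f m → a * m = m * b)
    (ht : ∀ t, InCorner f e t → t * a = b * t) {x : A} (hx : InCorner e e x) :
    a * x = x * a := by
  rw [← sub_eq_zero]
  refine hQ _ ((ha.mul hx).sub (hx.mul ha)) (fun m h => ?_) (fun t h => ?_)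
  · rw [sub_mul, mul_assoc, hm _ (hx.mul h), mul_assoc x a, hm _ h, mul_assoc, sub_self]
  · rw [mul_sub, ← mul_assoc, ht _ h, ← mul_assoc t x, ht _ (h.mul hx), mul_assoc, sub_self]

lemma isCent_of_diagonal {e f : A} (hc : PeircePair e f) (hQ : HalfQ e f) (hQ' : HalfQ f e) {a b : A}
    (ha : InCorner e e a) (hb : InCorner f f b) (hm : ∀ m, InCorner e f m → a * m = m * b)
    (ht : ∀ t, InCorner f e t → t * a = b * t) : IsCent (a + b) := by
  intro y
  have h1 := hQ.commute ha hm ht (inCorner_mul_mul hc.left hc.left y)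
  have h2 := hQ'.commute hb (fun t h => (ht t h).symm) (fun m h => (hm m h).symm)
    (inCorner_mul_mul hc.right hc.right y)
  have h3 := hm _ (inCorner_mul_mul hc.left hc.right y)
  have h4 := ht _ (inCorner_mul_mul hc.right hc.left y)
  have key : ∀ {p q r s : A}, InCorner p q a → q * r = 0 → a * (r * y * s) = 0 := by
    intro p q r s h h'
    rw [mul_assoc, ← mul_assoc, h.right_eq_zero h', zero_mul]
  have keyb : ∀ {p q r s : A}, InCorner p q b → q * r = 0 → b * (r * y * s) = 0 := by
    intro p q r s h h'
    rw [mul_assoc, ← mul_assoc, h.right_eq_zero h', zero_mul]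
  have key' : ∀ {p q r s : A}, InCorner p q a → s * p = 0 → (r * y * s) * a = 0 := by
    intro p q r s h h'
    rw [mul_assoc, h.left_eq_zero h', mul_zero]
  have keyb' : ∀ {p q r s : A}, InCorner p q b → s * p = 0 → (r * y * s) * b = 0 := by
    intro p q r s h h'
    rw [mul_assoc, h.left_eq_zero h', mul_zero]
  rw [hc.decomp y]
  simp only [mul_add, add_mul, key ha hc.mul, key' ha hc.mul', keyb hb hc.mul', keyb' hb hc.mul,
    h1, h2, h3, h4]
  abel

/-- A central element is determined by either of its diagonal corners. -/
lemma HalfQ.eq_zero_of_isCent {e f : A} (hc : PeircePair e f) (hQ : HalfQ e f) {z : A}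
    (hz : IsCent z) (h : f * z * f = 0) : z = 0 := by
  have hzf : z * f = 0 := by rw [← h, ← hz f, mul_assoc, hc.right]
  have hze : z * e = z := by
    conv_rhs => rw [← mul_one z, ← hc.add, mul_add, hzf, add_zero]
  refine hQ z ⟨by rw [← hz, hze], hze⟩ (fun m hm => ?_) (fun t ht => ?_)
  · rw [hz, ← hm.2, mul_assoc, ← hz, hzf, mul_zero]
  · rw [← hz, ← ht.1, ← mul_assoc, hzf, zero_mul]

lemma HalfQ.eq_of_isCent {e f : A} (hc : PeircePair e f) (hQ : HalfQ e f) {z w : A}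
    (hz : IsCent z) (hw : IsCent w) (h : f * z * f = f * w * f) : z = w := by
  rw [← sub_eq_zero]
  refine hQ.eq_zero_of_isCent hc (fun y => by rw [sub_mul, mul_sub, hz, hw]) ?_
  rw [mul_sub, sub_mul, h, sub_self]

/-- A linear map whose values are `f`-corners of central elements lifts to the centre. -/
lemma exists_central_lift {e f : A} (hc : PeircePair e f) (hQ : HalfQ e f) (ψ : A →ₗ[R] A)
    (h : ∀ x, ∃ z, IsCent z ∧ ψ x = f * z * f) :
    ∃ γ : A →ₗ[R] A, ∀ x, IsCent (γ x) ∧ ψ x = f * γ x * f := by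
  choose g hg hψ using h
  refine ⟨{ toFun := g, map_add' := fun x y => ?_, map_smul' := fun r x => ?_ },
    fun x => ⟨hg x, hψ x⟩⟩
  · refine hQ.eq_of_isCent hc (hg _) (fun w => by rw [add_mul, mul_add, hg, hg]) ?_
    rw [← hψ, map_add, mul_add, add_mul, ← hψ, ← hψ]
  · refine hQ.eq_of_isCent hc (hg _) (fun w => by simp [hg x w]) ?_
    rw [← hψ, map_smul, hψ]
    simp

/-- `d` preserves every Peirce corner. -/
def PreservesCorners (e f : A) (d : A →ₗ[R] A) : Prop :=
  (∀ x, InCorner e e x → InCorner e e (d x)) ∧ (∀ x, InCorner e f x → InCorner e f (d x)) ∧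
  (∀ x, InCorner f e x → InCorner f e (d x)) ∧ (∀ x, InCorner f f x → InCorner f f (d x))

lemma HalfQ.leibniz {e f : A} (hQ : HalfQ e f) {d : A →ₗ[R] A}
    (hd : ∀ x, InCorner e e x → InCorner e e (d x))
    (ham : ∀ a m, InCorner e e a → InCorner e f m → d (a * m) = d a * m + a * d m)
    (hta : ∀ t a, InCorner f e t → InCorner e e a → d (t * a) = d t * a + t * d a)
    {x y : A} (hx : InCorner e e x) (hy : InCorner e e y) : d (x * y) = d x * y + x * d y := by
  rw [← sub_eq_zero]
  refine hQ _ ((hd _ (hx.mul hy)).sub (((hd _ hx).mul hy).add (hx.mul (hd _ hy))))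
    (fun m hm => ?_) (fun t ht => ?_)
  · have h1 := ham _ _ (hx.mul hy) hm
    rw [mul_assoc, ham _ _ hx (hy.mul hm), ham _ _ hy hm] at h1
    rw [sub_mul, eq_sub_of_add_eq h1.symm]
    noncomm_ring
  · have h1 := hta _ _ ht (hx.mul hy)
    rw [← mul_assoc, hta _ _ (ht.mul hx) hy, hta _ _ ht hx] at h1
    rw [mul_sub, eq_sub_of_add_eq' h1.symm]
    noncomm_ring

lemma isDeriv_of_corners {e f : A} (hc : PeircePair e f) (hQ : HalfQ e f) (hQ' : HalfQ f e)
    {d : A →ₗ[R] A} (hd : PreservesCorners e f d)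
    (ham : ∀ a m, InCorner e e a → InCorner e f m → d (a * m) = d a * m + a * d m)
    (hmb : ∀ m b, InCorner e f m → InCorner f f b → d (m * b) = d m * b + m * d b)
    (hta : ∀ t a, InCorner f e t → InCorner e e a → d (t * a) = d t * a + t * d a)
    (hbt : ∀ b t, InCorner f f b → InCorner f e t → d (b * t) = d b * t + b * d t)
    (hmt : ∀ m t, InCorner e f m → InCorner f e t → d (m * t) = d m * t + m * d t)
    (htm : ∀ t m, InCorner f e t → InCorner e f m → d (t * m) = d t * m + t * d m) :
    IsDeriv d := by
  obtain ⟨hee, hef, hfe, hff⟩ := hd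
  have zero : ∀ {p q r s x y : A}, q * r = 0 → InCorner p q x → InCorner p q (d x) →
      InCorner r s y → InCorner r s (d y) → d (x * y) = d x * y + x * d y := by
    intro p q r s x y h hx hdx hy hdy
    rw [hx.mul_eq_zero hy h, hdx.mul_eq_zero hy h, hx.mul_eq_zero hdy h, map_zero, add_zero]
  have addl : ∀ {x x' y : A}, d (x * y) = d x * y + x * d y →
      d (x' * y) = d x' * y + x' * d y → d ((x + x') * y) = d (x + x') * y + (x + x') * d y := by
    intro x x' y h h'
    rw [add_mul, map_add, map_add, h, h']; noncomm_ring
  have addr : ∀ {x y y' : A}, d (x * y) = d x * y + x * d y →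
      d (x * y') = d x * y' + x * d y' → d (x * (y + y')) = d x * (y + y') + x * d (y + y') := by
    intro x y y' h h'
    rw [mul_add, map_add, map_add, h, h']; noncomm_ring
  intro x y
  have x1 := inCorner_mul_mul hc.left hc.left x
  have x2 := inCorner_mul_mul hc.left hc.right x
  have x3 := inCorner_mul_mul hc.right hc.left x
  have x4 := inCorner_mul_mul hc.right hc.right x
  have y1 := inCorner_mul_mul hc.left hc.left y
  have y2 := inCorner_mul_mul hc.left hc.right y
  have y3 := inCorner_mul_mul hc.right hc.left y
  have y4 := inCorner_mul_mul hc.right hc.right y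
  rw [hc.decomp x, hc.decomp y]
  refine addl (addl ?_ ?_) (addl ?_ ?_) <;> refine addr (addr ?_ ?_) (addr ?_ ?_)
  · exact hQ.leibniz hee ham hta x1 y1
  · exact ham _ _ x1 y2
  · exact zero hc.mul x1 (hee _ x1) y3 (hfe _ y3)
  · exact zero hc.mul x1 (hee _ x1) y4 (hff _ y4)
  · exact zero hc.mul' x2 (hef _ x2) y1 (hee _ y1)
  · exact zero hc.mul' x2 (hef _ x2) y2 (hef _ y2)
  · exact hmt _ _ x2 y3
  · exact hmb _ _ x2 y4
  · exact hta _ _ x3 y1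
  · exact htm _ _ x3 y2
  · exact zero hc.mul x3 (hfe _ x3) y3 (hfe _ y3)
  · exact zero hc.mul x3 (hfe _ x3) y4 (hff _ y4)
  · exact zero hc.mul' x4 (hff _ x4) y1 (hee _ y1)
  · exact zero hc.mul' x4 (hff _ x4) y2 (hef _ y2)
  · exact hbt _ _ x4 y3
  · exact hQ'.leibniz hff hbt hmb x4 y4

end Corners

section Main

variable {R A : Type*} [CommRing R] [Ring A] [Algebra R A]

lemma exists_pCom_eq_commutator (N : ℕ) {e x : A} {s : ℤ} (hx : x * e - e * x = s • x) (y : A) :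
    ∃ u : ℕ → A, pCom u (N + 1) = s ^ N • (x * y - y * x) := by
  let u : ℕ → A := fun i => if i = 0 then x else if i = N + 1 then y else e
  have hu : pCom u N = s ^ N • x := by
    refine pCom_eq_pow_smul hx (Nat.zero_le N) (by simp [pCom, u]) fun i hi hi' => ?_
    simp only [u]; rw [if_neg (by omega), if_neg (by omega)]
  refine ⟨u, ?_⟩
  rw [pCom, hu, show u (N + 1) = y by simp [u], smul_sub, smul_mul_assoc, mul_smul_comm]

lemma mul_pCom_mul {e p q : A} {s : ℤ}
    (h : ∀ y, p * (y * e - e * y) * q = s • (p * y * q)) (y : A) (k : ℕ) :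
    p * pCom (fun i => if i = 0 then y else e) k * q = s ^ k • (p * y * q) := by
  induction k with
  | zero => simp [pCom]
  | succ k ih =>
    rw [pCom, if_neg (Nat.succ_ne_zero k), h, ih, smul_smul, pow_succ']

namespace PeircePair

variable {e f : A}

lemma upper (hc : PeircePair e f) (y : A) :
    e * (y * e - e * y) * f = (-1 : ℤ) • (e * y * f) := by
  rw [mul_sub, sub_mul, mul_assoc e (y * e), mul_assoc y, hc.mul, ← mul_assoc e e, hc.left]
  simp

lemma lower (hc : PeircePair e f) (y : A) :
    f * (y * e - e * y) * e = (1 : ℤ) • (f * y * e) := by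
  rw [mul_sub, sub_mul, mul_assoc f (y * e), mul_assoc y, hc.left, ← mul_assoc f e, hc.mul']
  simp [mul_assoc]

lemma diag_left (hc : PeircePair e f) (y : A) :
    e * (y * e - e * y) * e = (0 : ℤ) • (e * y * e) := by
  rw [mul_sub, sub_mul, mul_assoc e (y * e), mul_assoc y, hc.left, ← mul_assoc e e, hc.left]
  simp [mul_assoc]

lemma diag_right (hc : PeircePair e f) (y : A) :
    f * (y * e - e * y) * f = (0 : ℤ) • (f * y * f) := by
  rw [mul_sub, sub_mul, mul_assoc f (y * e), mul_assoc y, hc.mul, ← mul_assoc f e, hc.mul']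
  simp

lemma eigen_upper (hc : PeircePair e f) {v : A} (hv : InCorner e f v) :
    v * e - e * v = (-1 : ℤ) • v := by
  rw [hv.right_eq_zero hc.mul', hv.1]; simp

lemma eigen_lower (hc : PeircePair e f) {v : A} (hv : InCorner f e v) :
    v * e - e * v = (1 : ℤ) • v := by
  rw [hv.left_eq_zero hc.mul, hv.2]; simp

lemma inCorner_of_eq_zero (hc : PeircePair e f) {x : A} (h1 : e * x * f = 0) (h2 : f * x * e = 0)
    (h3 : f * x * f = 0) : InCorner e e x := by
  have h := hc.decomp x
  rw [h1, h2, h3, add_zero, add_zero, add_zero] at h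
  rw [h]
  exact inCorner_mul_mul hc.left hc.left x

lemma inCorner_of_eq_zero' (hc : PeircePair e f) {x : A} (h1 : e * x * e = 0) (h2 : f * x * e = 0)
    (h3 : f * x * f = 0) : InCorner e f x := by
  have h := hc.decomp x
  rw [h1, h2, h3, zero_add, add_zero, add_zero] at h
  rw [h]
  exact inCorner_mul_mul hc.left hc.right x

lemma sandwich_isCent (hc : PeircePair e f) {z : A} (hz : IsCent z) : e * z * f = 0 := by
  rw [← hz, mul_assoc, hc.mul, mul_zero]

end PeircePair

lemma zsmul_pow_eq_zero {s : ℤ} (hs : s * s = 1) {N : ℕ} {v : A} (h : s ^ N • v = 0) : v = 0 :=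
  pow_smul_cancel hs N (h.trans (smul_zero _).symm)

/-- If `φ e` normalizes the off-diagonal corner `pAq`, then it centralizes it, and `φ` maps this
corner to off-diagonal elements. -/
lemma IsLieNDeriv.map_offdiagonal {N : ℕ} {φ : A →ₗ[R] A} (hφ : IsLieNDeriv (N + 2) φ)
    (hN : TorsionFreeAt A (N + 1)) {e f p q : A} (hc : PeircePair e f) {s : ℤ} (hs : s * s = 1)
    (hpq : ∀ y, p * (y * e - e * y) * q = s • (p * y * q))
    (heig : ∀ v, InCorner p q v → v * e - e * v = s • v) {v : A} (hv : InCorner p q v)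
    (hw : InCorner p q (v * φ e - φ e * v)) :
    v * φ e = φ e * v ∧ e * φ v * e = 0 ∧ f * φ v * f = 0 := by
  have h := hφ.map_eigen (heig v hv) rfl (heig _ hw)
  have hw0 : v * φ e - φ e * v = 0 := by
    have h' := congrArg (fun y => p * y * q) h
    simp only [mul_add, add_mul, mul_smul_comm, smul_mul_assoc, mul_pCom_mul hpq, hw.eq] at h'
    exact zsmul_pow_eq_zero hs (hN _ (left_eq_add.mp h'))
  rw [hw0, smul_zero, smul_zero, add_zero] at h
  refine ⟨sub_eq_zero.mp hw0, zsmul_pow_eq_zero hs (N := N + 1) ?_,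
    zsmul_pow_eq_zero hs (N := N + 1) ?_⟩
  · rw [← smul_mul_assoc, ← mul_smul_comm, h, mul_pCom_mul hc.diag_left, zero_pow (by omega),
      zero_smul]
  · rw [← smul_mul_assoc, ← mul_smul_comm, h, mul_pCom_mul hc.diag_right, zero_pow (by omega),
      zero_smul]

/-- If `φ e` is central then `φ` maps elements commuting with `e` to diagonal elements. -/
lemma IsLieNDeriv.map_diagonal {N : ℕ} {φ : A →ₗ[R] A} (hφ : IsLieNDeriv (N + 2) φ)
    {e f : A} (hc : PeircePair e f) (he : IsCent (φ e)) {v : A} (hv : v * e = e * v) :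
    e * φ v * f = 0 ∧ f * φ v * e = 0 := by
  have h := hφ.map_eigen (e := e) (v := v) (w := 0) (s := 0) (by rw [hv]; simp)
    (by rw [he, sub_self]) (by simp)
  rw [smul_zero, smul_zero, add_zero, zero_pow (by omega), zero_smul] at h
  have h1 := mul_pCom_mul hc.upper (φ v) (N + 1)
  have h2 := mul_pCom_mul hc.lower (φ v) (N + 1)
  rw [← h, mul_zero, zero_mul] at h1 h2
  exact ⟨zsmul_pow_eq_zero (by norm_num) h1.symm, zsmul_pow_eq_zero (by norm_num) h2.symm⟩

/-- The sufficient conditions for a Lie `n`-derivation to be standard. -/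
structure CornerConditions (e f : A) (φ : A →ₗ[R] A) : Prop where
  left : ∀ a, ∃ z, IsCent z ∧ f * φ (e * a * e) * f = f * z * f
  right : ∀ b, ∃ z, IsCent z ∧ e * φ (f * b * f) * e = e * z * e
  prod : ∀ m t, IsCent (e * φ ((f * t * e) * (e * m * f)) * e +
    f * φ ((e * m * f) * (f * t * e)) * f)
  upper : ∀ m, f * φ (e * m * f) * e = 0
  lower : ∀ t, e * φ (f * t * e) * f = 0

theorem IsLieNDeriv.isStandard_of_diagonal {N : ℕ} {φ : A →ₗ[R] A}
    (hφ : IsLieNDeriv (N + 2) φ) (hN : TorsionFreeAt A (N + 1)) {e f : A} (hc : PeircePair e f)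
    (hQ : HalfQ e f) (hQ' : HalfQ f e) (hφe : e * φ e * f = 0) (hφe' : f * φ e * e = 0)
    (H : CornerConditions e f φ) : IsStandardLieNDeriv (N + 2) φ := by
  have hdec : φ e = e * φ e * e + f * φ e * f := by
    conv_lhs => rw [hc.decomp (φ e), hφe, hφe', add_zero, zero_add]
  have ca := inCorner_mul_mul hc.left hc.left (φ e)
  have cb := inCorner_mul_mul hc.right hc.right (φ e)
  have comm_upper : ∀ m, InCorner e f m →
      m * φ e - φ e * m = m * (f * φ e * f) - (e * φ e * e) * m := by
    intro m hm
    rw [hdec, mul_add, add_mul, hm.mul_eq_zero ca hc.mul', cb.mul_eq_zero hm hc.mul', zero_add,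
      add_zero, ← hdec]
  have comm_lower : ∀ t, InCorner f e t →
      t * φ e - φ e * t = t * (e * φ e * e) - (f * φ e * f) * t := by
    intro t ht
    rw [hdec, mul_add, add_mul, ht.mul_eq_zero cb hc.mul, ca.mul_eq_zero ht hc.mul, zero_add,
      add_zero, ← hdec]
  have upper := fun m (hm : InCorner e f m) =>
    hφ.map_offdiagonal hN hc (by norm_num) hc.upper (fun _ => hc.eigen_upper) hm
      (by rw [comm_upper m hm]; exact (hm.mul cb).sub (ca.mul hm))
  have lower := fun t (ht : InCorner f e t) =>
    hφ.map_offdiagonal hN hc (by norm_num) hc.lower (fun _ => hc.eigen_lower) ht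
      (by rw [comm_lower t ht]; exact (ht.mul ca).sub (cb.mul ht))
  have hcent : IsCent (φ e) := by
    rw [hdec]
    refine isCent_of_diagonal hc hQ hQ' ca cb (fun m hm => ?_) (fun t ht => ?_)
    · have := comm_upper m hm
      rw [(upper m hm).1, sub_self] at this
      exact (sub_eq_zero.mp this.symm).symm
    · have := comm_lower t ht
      rw [(lower t ht).1, sub_self] at this
      exact sub_eq_zero.mp this.symm
  have φef : ∀ m, InCorner e f m → InCorner e f (φ m) := fun m hm =>
    hc.inCorner_of_eq_zero' (upper m hm).2.1 (by rw [← hm.eq]; exact H.upper m) (upper m hm).2.2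
  have φfe : ∀ t, InCorner f e t → InCorner f e (φ t) := fun t ht =>
    hc.symm.inCorner_of_eq_zero' (lower t ht).2.2 (by rw [← ht.eq]; exact H.lower t)
      (lower t ht).2.1
  obtain ⟨γ₁, hγ₁⟩ := exists_central_lift hc hQ
    ((LinearMap.mulLeftRight R (f, f)) ∘ₗ φ ∘ₗ (LinearMap.mulLeftRight R (e, e)))
    (by simpa using H.left)
  obtain ⟨γ₂, hγ₂⟩ := exists_central_lift hc.symm hQ'
    ((LinearMap.mulLeftRight R (e, e)) ∘ₗ φ ∘ₗ (LinearMap.mulLeftRight R (f, f)))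
    (by simpa using H.right)
  simp only [LinearMap.comp_apply, LinearMap.mulLeftRight_apply] at hγ₁ hγ₂
  have γ₁_zero : ∀ {x}, e * x * e = 0 → γ₁ x = 0 := fun {x} h =>
    hQ.eq_zero_of_isCent hc (hγ₁ x).1 (by rw [← (hγ₁ x).2, h, map_zero, mul_zero, zero_mul])
  have γ₂_zero : ∀ {x}, f * x * f = 0 → γ₂ x = 0 := fun {x} h =>
    hQ'.eq_zero_of_isCent hc.symm (hγ₂ x).1
      (by rw [← (hγ₂ x).2, h, map_zero, mul_zero, zero_mul])
  let γ := γ₁ + γ₂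
  have hγ : ∀ x, IsCent (γ x) := fun x y => by
    simp only [γ, LinearMap.add_apply, add_mul, mul_add, (hγ₁ x).1 y, (hγ₂ x).1 y]
  have γef : ∀ m, InCorner e f m → γ m = 0 := fun m hm => by
    simp only [γ, LinearMap.add_apply]
    rw [γ₁_zero (by rw [mul_assoc, hm.right_eq_zero hc.mul', mul_zero]),
      γ₂_zero (by rw [hm.left_eq_zero hc.mul', zero_mul]), add_zero]
  have γfe : ∀ t, InCorner f e t → γ t = 0 := fun t ht => by
    simp only [γ, LinearMap.add_apply]
    rw [γ₁_zero (by rw [ht.left_eq_zero hc.mul, zero_mul]),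
      γ₂_zero (by rw [mul_assoc, ht.right_eq_zero hc.mul, mul_zero]), add_zero]
  have γee : ∀ a, InCorner e e a → f * γ a * f = f * φ a * f := fun a ha => by
    simp only [γ, LinearMap.add_apply]
    rw [γ₂_zero (by rw [ha.left_eq_zero hc.mul', zero_mul]), add_zero, ← (hγ₁ a).2, ha.eq]
  have γff : ∀ b, InCorner f f b → e * γ b * e = e * φ b * e := fun b hb => by
    simp only [γ, LinearMap.add_apply]
    rw [γ₁_zero (by rw [hb.left_eq_zero hc.mul, zero_mul]), zero_add, ← (hγ₂ b).2, hb.eq]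
  let d := φ - γ
  have hφd : ∀ x, φ x = d x + γ x := fun x => by simp [d]
  have dee : ∀ a, InCorner e e a → InCorner e e (d a) := fun a ha => by
    have h := hφ.map_diagonal hc hcent (v := a) (by rw [ha.1, ha.2])
    apply hc.inCorner_of_eq_zero <;> simp only [d, LinearMap.sub_apply, mul_sub, sub_mul]
    · rw [h.1, hc.sandwich_isCent (hγ a), sub_self]
    · rw [h.2, hc.symm.sandwich_isCent (hγ a), sub_self]
    · rw [γee a ha, sub_self]
  have dff : ∀ b, InCorner f f b → InCorner f f (d b) := fun b hb => by
    have h := hφ.map_diagonal hc hcent (v := b)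
      (by rw [hb.right_eq_zero hc.mul', hb.left_eq_zero hc.mul])
    apply hc.symm.inCorner_of_eq_zero <;> simp only [d, LinearMap.sub_apply, mul_sub, sub_mul]
    · rw [h.2, hc.symm.sandwich_isCent (hγ b), sub_self]
    · rw [h.1, hc.sandwich_isCent (hγ b), sub_self]
    · rw [γff b hb, sub_self]
  have d_ef : ∀ m, InCorner e f m → InCorner e f (d m) := fun m hm => by
    simpa [d, γef m hm] using φef m hm
  have dfe : ∀ t, InCorner f e t → InCorner f e (d t) := fun t ht => by
    simpa [d, γfe t ht] using φfe t ht
  have hcomm : ∀ x y, φ x * y - y * φ x + (x * φ y - φ y * x) =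
      d x * y - y * d x + (x * d y - d y * x) := fun x y => by
    rw [hφd x, hφd y, add_mul, mul_add, add_mul, mul_add, hγ x y, hγ y x]; abel
  have lie_upper : ∀ {x y v w}, InCorner e f v → InCorner e f w → x * y - y * x = v →
      d x * y - y * d x + (x * d y - d y * x) = w → d v = w := by
    intro x y v w hv hw hxy hw'
    rw [← hcomm] at hw'
    have := hφ.map_commutator_of_eigen hcent (s := -1) (by norm_num)
      (by rw [hxy]; exact hc.eigen_upper hv) hw' (hc.eigen_upper hw)
    rw [← this, hxy, hφd v, γef v hv, add_zero]
  have lie_lower : ∀ {x y v w}, InCorner f e v → InCorner f e w → x * y - y * x = v →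
      d x * y - y * d x + (x * d y - d y * x) = w → d v = w := by
    intro x y v w hv hw hxy hw'
    rw [← hcomm] at hw'
    have := hφ.map_commutator_of_eigen hcent (s := 1) (by norm_num)
      (by rw [hxy]; exact hc.eigen_lower hv) hw' (hc.eigen_lower hw)
    rw [← this, hxy, hφd v, γfe v hv, add_zero]
  have γcomm : ∀ m t, InCorner e f m → InCorner f e t → γ (m * t) = γ (t * m) := by
    intro m t hm ht
    have hz := H.prod m t
    rw [hm.eq, ht.eq] at hz
    have h1 := hQ'.eq_of_isCent hc.symm hz (hγ (t * m)) (by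
      rw [γff _ (ht.mul hm), mul_add, add_mul, (inCorner_mul_mul hc.left hc.left _).eq,
        (inCorner_mul_mul hc.right hc.right _).left_eq_zero hc.mul, zero_mul, add_zero])
    have h2 := hQ.eq_of_isCent hc hz (hγ (m * t)) (by
      rw [γee _ (hm.mul ht), mul_add, add_mul, (inCorner_mul_mul hc.right hc.right _).eq,
        (inCorner_mul_mul hc.left hc.left _).left_eq_zero hc.mul', zero_mul, zero_add])
    rw [← h1, ← h2]
  have lie_mixed : ∀ m t, InCorner e f m → InCorner f e t →
      d (m * t) - (d m * t + m * d t) = d (t * m) - (d t * m + t * d m) := by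
    intro m t hm ht
    have h := hφ.map_commutator_of_eigen_left hcent (s := -1) (by norm_num) (y := t)
      (hc.eigen_upper hm) (hc.eigen_upper (φef m hm))
    rw [hcomm, map_sub, hφd (m * t), hφd (t * m), γcomm m t hm ht, add_sub_add_right_eq_sub] at h
    rw [sub_eq_iff_eq_add.mp h]
    abel
  have mixed_zero : ∀ m t, InCorner e f m → InCorner f e t →
      d (m * t) - (d m * t + m * d t) = 0 := by
    intro m t hm ht
    have h1 := (dee _ (hm.mul ht)).sub (((d_ef m hm).mul ht).add (hm.mul (dfe t ht)))
    have h2 := (dff _ (ht.mul hm)).sub (((dfe t ht).mul hm).add (ht.mul (d_ef m hm)))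
    rw [← h1.1, lie_mixed m t hm ht, h2.left_eq_zero hc.mul]
  have hd : IsDeriv d := by
    refine isDeriv_of_corners hc hQ hQ' ⟨dee, d_ef, dfe, dff⟩ ?_ ?_ ?_ ?_ ?_ ?_
    · intro a m ha hm
      refine lie_upper (ha.mul hm) (((dee a ha).mul hm).add (ha.mul (d_ef m hm)))
        (x := a) (y := m) ?_ ?_
      · rw [hm.mul_eq_zero ha hc.mul', sub_zero]
      · rw [hm.mul_eq_zero (dee a ha) hc.mul', (d_ef m hm).mul_eq_zero ha hc.mul', sub_zero,
          sub_zero]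
    · intro m b hm hb
      refine lie_upper (hm.mul hb) (((d_ef m hm).mul hb).add (hm.mul (dff b hb)))
        (x := m) (y := b) ?_ ?_
      · rw [hb.mul_eq_zero hm hc.mul', sub_zero]
      · rw [hb.mul_eq_zero (d_ef m hm) hc.mul', (dff b hb).mul_eq_zero hm hc.mul', sub_zero,
          sub_zero]
    · intro t a ht ha
      refine lie_lower (ht.mul ha) (((dfe t ht).mul ha).add (ht.mul (dee a ha)))
        (x := t) (y := a) ?_ ?_
      · rw [ha.mul_eq_zero ht hc.mul, sub_zero]
      · rw [ha.mul_eq_zero (dfe t ht) hc.mul, (dee a ha).mul_eq_zero ht hc.mul, sub_zero,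
          sub_zero]
    · intro b t hb ht
      refine lie_lower (hb.mul ht) (((dff b hb).mul ht).add (hb.mul (dfe t ht)))
        (x := b) (y := t) ?_ ?_
      · rw [ht.mul_eq_zero hb hc.mul, sub_zero]
      · rw [ht.mul_eq_zero (dff b hb) hc.mul, (dfe t ht).mul_eq_zero hb hc.mul, sub_zero,
          sub_zero]
    · intro m t hm ht
      exact sub_eq_zero.mp (mixed_zero m t hm ht)
    · intro t m ht hm
      exact sub_eq_zero.mp ((lie_mixed m t hm ht).symm.trans (mixed_zero m t hm ht))
  have hφdγ : φ = d + γ := by simp [d]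
  refine ⟨d, γ, hd, hγ, vanishesOnNCommutators_of_isLieNDeriv ?_ hγ, hφdγ⟩
  have := hφ.sub_isDeriv hd
  rwa [hφdγ, add_sub_cancel_left] at this

lemma IsDeriv.mul_map_mul {d : A →ₗ[R] A} (hd : IsDeriv d) {p q r s : A} (h : r * p = 0)
    (h' : q * s = 0) (x : A) : r * d (p * x * q) * s = 0 := by
  rw [hd, mul_assoc p x, mul_add, add_mul, ← mul_assoc r p, h, mul_assoc r, mul_assoc _ q, h']
  simp

lemma IsDeriv.add {d d' : A →ₗ[R] A} (hd : IsDeriv d) (hd' : IsDeriv d') : IsDeriv (d + d') := by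
  intro x y
  simp only [LinearMap.add_apply, hd x y, hd' x y]
  noncomm_ring

/-- The inner derivation `x ↦ [u, x]`. -/
def innerDeriv (R : Type*) {A : Type*} [CommRing R] [Ring A] [Algebra R A] (u : A) : A →ₗ[R] A :=
  LinearMap.mulLeft R u - LinearMap.mulRight R u

lemma innerDeriv_apply (u x : A) : innerDeriv R u x = u * x - x * u := rfl

lemma isDeriv_innerDeriv (u : A) : IsDeriv (innerDeriv R u) := by
  intro x y
  simp only [innerDeriv_apply]
  noncomm_ring

lemma PeircePair.mul_prod (e f m t : A) :
    (f * t * e) * (e * m * f) = f * (t * e * e * m) * f := by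
  simp only [mul_assoc]

lemma CornerConditions.sub {e f : A} (hc : PeircePair e f) {φ d : A →ₗ[R] A} (hd : IsDeriv d)
    (H : CornerConditions e f φ) : CornerConditions e f (φ - d) where
  left a := by
    obtain ⟨z, hz, h⟩ := H.left a
    exact ⟨z, hz, by rw [LinearMap.sub_apply, mul_sub, sub_mul, h,
      hd.mul_map_mul hc.mul' hc.mul, sub_zero]⟩
  right b := by
    obtain ⟨z, hz, h⟩ := H.right b
    exact ⟨z, hz, by rw [LinearMap.sub_apply, mul_sub, sub_mul, h,
      hd.mul_map_mul hc.mul hc.mul', sub_zero]⟩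
  prod m t := by
    have h := H.prod m t
    rw [PeircePair.mul_prod e f m t, PeircePair.mul_prod f e t m] at h ⊢
    rw [LinearMap.sub_apply, LinearMap.sub_apply, mul_sub, sub_mul, mul_sub, sub_mul,
      hd.mul_map_mul hc.mul' hc.mul, hd.mul_map_mul hc.mul hc.mul', sub_zero, sub_zero]
    exact h
  upper m := by
    rw [LinearMap.sub_apply, mul_sub, sub_mul, H.upper, hd.mul_map_mul hc.mul' hc.mul', sub_zero]
  lower t := by
    rw [LinearMap.sub_apply, mul_sub, sub_mul, H.lower, hd.mul_map_mul hc.mul hc.mul, sub_zero]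

theorem CornerConditions.of_isStandard {N : ℕ} {φ : A →ₗ[R] A} {e f : A} (hc : PeircePair e f)
    (h : IsStandardLieNDeriv (N + 2) φ) : CornerConditions e f φ := by
  obtain ⟨d, γ, hd, hγ, hv, rfl⟩ := h
  have hcomm : ∀ m t, InCorner e f m → γ (m * t) = γ (t * m) := by
    intro m t hm
    obtain ⟨u, hu⟩ := exists_pCom_eq_commutator N (hc.eigen_upper hm) t
    have h := hv u
    rw [show N + 2 - 1 = N + 1 by omega, hu, map_zsmul] at h
    have := zsmul_pow_eq_zero (by norm_num) h
    rwa [map_sub, sub_eq_zero] at this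
  suffices H : CornerConditions e f γ by
    have hd' : IsDeriv (-d) := fun x y => by
      simp only [LinearMap.neg_apply, hd x y]; noncomm_ring
    have := H.sub hc hd'
    rwa [sub_neg_eq_add, add_comm] at this
  refine ⟨fun a => ⟨_, hγ _, rfl⟩, fun b => ⟨_, hγ _, rfl⟩, fun m t => ?_,
    fun m => hc.symm.sandwich_isCent (hγ _), fun t => hc.sandwich_isCent (hγ _)⟩
  rw [hcomm _ _ (inCorner_mul_mul hc.left hc.right m)]
  generalize hz : γ ((f * t * e) * (e * m * f)) = z
  have hzc : IsCent z := hz ▸ hγ _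
  rw [← hzc e, ← hzc f, mul_assoc, mul_assoc, hc.left, hc.right, ← mul_add, hc.add, mul_one]
  exact hzc

theorem IsLieNDeriv.isStandard_of_cornerConditions {N : ℕ} {φ : A →ₗ[R] A}
    (hφ : IsLieNDeriv (N + 2) φ) (hN : TorsionFreeAt A (N + 1)) {e f : A} (hc : PeircePair e f)
    (hQ : HalfQ e f) (hQ' : HalfQ f e) (H : CornerConditions e f φ) :
    IsStandardLieNDeriv (N + 2) φ := by
  let δ := innerDeriv R (f * φ e * e - e * φ e * f)
  have hδ : IsDeriv δ := isDeriv_innerDeriv _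
  have c1 := inCorner_mul_mul hc.left hc.right (φ e)
  have c2 := inCorner_mul_mul hc.right hc.left (φ e)
  have hδe : δ e = f * φ e * e + e * φ e * f := by
    simp only [δ, innerDeriv_apply, sub_mul, mul_sub]
    rw [c1.right_eq_zero hc.mul', c2.left_eq_zero hc.mul, c2.2, ← mul_assoc, ← mul_assoc, hc.left]
    abel
  obtain ⟨d, γ, hd, hγ, hv, h⟩ := (hφ.sub_isDeriv hδ).isStandard_of_diagonal hN hc hQ hQ'
    (by
      rw [LinearMap.sub_apply, hδe, mul_sub, sub_mul, mul_add, add_mul, c1.eq,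
        c2.left_eq_zero hc.mul, zero_mul, zero_add, sub_self])
    (by
      rw [LinearMap.sub_apply, hδe, mul_sub, sub_mul, mul_add, add_mul, c2.eq,
        c1.left_eq_zero hc.mul', zero_mul, add_zero, sub_self])
    (H.sub hc hδ)
  exact ⟨d + δ, γ, hd.add hδ, hγ, hv, by rw [← sub_add_cancel φ δ, h]; abel⟩

lemma PropQ.halfQ {e : A} (hc : PeircePair e (1 - e)) (h : PropQ e) :
    HalfQ e (1 - e) ∧ HalfQ (1 - e) e := by
  refine ⟨fun x hx hm ht => ?_, fun x hx ht hm => ?_⟩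
  · have := h.1 x
    rw [hx.eq] at this
    exact this ⟨fun y => hm _ (inCorner_mul_mul hc.left hc.right y),
      fun y => ht _ (inCorner_mul_mul hc.right hc.left y)⟩
  · have := h.2 x
    rw [hx.eq] at this
    exact this ⟨fun y => hm _ (inCorner_mul_mul hc.left hc.right y),
      fun y => ht _ (inCorner_mul_mul hc.right hc.left y)⟩

end Main

theorem stmt_4 (R : Type*) [CommRing R] (A : Type*) [Ring A] [Algebra R A]
    (n : ℕ) (hn : 2 ≤ n)
    (h2 : TorsionFreeAt A 2) (hn1 : TorsionFreeAt A (n - 1))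
    (e : A) (he : e * e = e) (he0 : e ≠ 0) (he1 : e ≠ 1) (hQ : PropQ e)
    (φ : A →ₗ[R] A) (hφ : IsLieNDeriv n φ) :
    IsStandardLieNDeriv n φ ↔
      ((∀ a : A, ∃ z : A, IsCent z ∧
          (1 - e) * φ (e * a * e) * (1 - e) = (1 - e) * z * (1 - e)) ∧
       (∀ b : A, ∃ z : A, IsCent z ∧
          e * φ ((1 - e) * b * (1 - e)) * e = e * z * e) ∧
       (∀ m t : A, IsCent
          (e * φ (((1 - e) * t * e) * (e * m * (1 - e))) * e +
           (1 - e) * φ ((e * m * (1 - e)) * ((1 - e) * t * e)) * (1 - e))) ∧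
       (∀ m : A, (1 - e) * φ (e * m * (1 - e)) * e = 0) ∧
       (∀ t : A, e * φ ((1 - e) * t * e) * (1 - e) = 0)) := by
  obtain ⟨N, rfl⟩ := Nat.exists_eq_add_of_le' hn
  have hc : PeircePair e (1 - e) :=
    ⟨he, (IsIdempotentElem.one_sub he).eq, by rw [mul_sub, mul_one, he, sub_self],
      by rw [sub_mul, one_mul, he, sub_self], by abel⟩
  obtain ⟨hQ₁, hQ₂⟩ := hQ.halfQ hc
  constructor
  · intro h
    obtain ⟨h1, h2, h3, h4, h5⟩ := CornerConditions.of_isStandard hc h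
    exact ⟨h1, h2, h3, h4, h5⟩
  · rintro ⟨h1, h2, h3, h4, h5⟩
    exact hφ.isStandard_of_cornerConditions hn1 hc hQ₁ hQ₂ ⟨h1, h2, h3, h4, h5⟩
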